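/- arXiv:1902.10233 — 7 statements merged into one kernel-verified Lean document; each statement's English description precedes it below -/
import Mathlib

section
/- Let A be a finite group. Then there exists a finite group G containing a solvable normal subgroup H such that G is an (internal) semidirect product of H by a subgroup isomorphic to A (i.e. G = H ⋊ A), and G possesses no characteristic conjugacy class of nontrivial cyclic subgroups: for every nontrivial cyclic subgroup C of G there exists an automorphism φ of G such that φ(C) is not G-conjugate to C. -/
/-- If the members of a large family of automorphisms move `g` into pairwise distinct
`ker r`-conjugacy classes, then one of them moves `g` away from all conjugates of its powers. -/
theorem exists_ne_conj_pow {G A ι : Type*} [Group G] [Group A] [Finite A] [Finite G]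
    (r : G →* A) (g : G) (e : ι → MulAut G)
    (hι : Nat.card A * orderOf g < Nat.card ι)
    (he : ∀ i j, ∀ n ∈ r.ker, e i g = n * e j g * n⁻¹ → i = j) :
    ∃ i, ∀ (x : G) (k : ℕ), e i g ≠ x * g ^ k * x⁻¹ := by
  by_contra! h
  choose x k hxk using h
  have hinj : Function.Injective
      (fun i ↦ (r (x i), (⟨g ^ k i, k i, by simp⟩ : Subgroup.zpowers g))) := by
    intro i j hij
    rw [Prod.mk.injEq] at hij
    refine he i j (x i * (x j)⁻¹) (by simp [MonoidHom.mem_ker, hij.1]) ?_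
    rw [hxk i, hxk j, show g ^ k i = g ^ k j from congrArg Subtype.val hij.2]
    group
  have hle := Nat.card_le_card_of_injective _ hinj
  rw [Nat.card_prod, Nat.card_zpowers] at hle
  omega

namespace SemidirectProduct

/-- The automorphism of a semidirect product by an abelian group given by a crossed
homomorphism. -/
def crossedShift {N A : Type*} [CommGroup N] [Group A] {φ : A →* MulAut N} (δ : A → N)
    (hδ : ∀ a b, δ (a * b) = δ a * φ a (δ b)) : MulAut (N ⋊[φ] A) where
  toFun g := ⟨g.left * δ g.right, g.right⟩
  invFun g := ⟨g.left / δ g.right, g.right⟩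
  left_inv g := by ext <;> simp
  right_inv g := by ext <;> simp
  map_mul' g h := by
    ext
    · simp only [mul_left, mul_right, hδ, map_mul]
      exact mul_mul_mul_comm _ _ _ _
    · rfl

end SemidirectProduct

/-- The automorphism of a power of an abelian group multiplying the `j`-th coordinate by the
`i`-th one. -/
def piTransvection {ι : Type*} [DecidableEq ι] (V : Type*) [CommGroup V] {i j : ι} (hij : i ≠ j) :
    MulAut (ι → V) where
  toFun v := v * Pi.mulSingle j (v i)
  invFun v := v / Pi.mulSingle j (v i)
  left_inv v := by simp [Pi.mulSingle_eq_of_ne hij]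
  right_inv v := by simp [Pi.mulSingle_eq_of_ne hij]
  map_mul' v w := by
    rw [Pi.mul_apply, Pi.mulSingle_mul]
    exact mul_mul_mul_comm _ _ _ _

theorem smul_mulSingle_apply {ι A V : Type*} [DecidableEq ι] [Group A] [CommGroup V]
    [MulDistribMulAction A V] (a : A) (j : ι) (v : V) :
    a • (Pi.mulSingle j v : ι → V) = Pi.mulSingle j (a • v) := by
  ext l
  by_cases hl : l = j
  · subst hl; simp
  · simp [Pi.mulSingle_eq_of_ne hl]

section

variable {A V ι : Type*} [Group A] [Finite A] [CommGroup V] [Finite V] [MulDistribMulAction A V]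

theorem orderOf_semidirect_pi_le
    (g : (ι → V) ⋊[MulDistribMulAction.toMulAut A (ι → V)] A) :
    orderOf g ≤ Nat.card A * Nat.card V := by
  refine orderOf_le_of_pow_eq_one (Nat.mul_pos Nat.card_pos Nat.card_pos) ?_
  have hr : (g ^ Nat.card A).right = 1 := by
    rw [← SemidirectProduct.rightHom_eq_right, map_pow, pow_card_eq_one']
  have hg : g ^ Nat.card A = SemidirectProduct.inl (g ^ Nat.card A).left := by
    ext
    · rfl
    · simpa using hr
  have hl : (g ^ Nat.card A).left ^ Nat.card V = 1 := by
    ext i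
    simp
  rw [pow_mul, hg, ← map_pow, hl, map_one]

theorem exists_aut_ne_conj_pow [Finite ι] (δ : A → V) (hδ : ∀ a b, δ (a * b) = δ a * a • δ b)
    (hδ_ne : ∀ a ≠ 1, ∀ v, δ a ≠ a • v / v)
    (hι : Nat.card A * (Nat.card A * Nat.card V) < Nat.card ι)
    (g : (ι → V) ⋊[MulDistribMulAction.toMulAut A (ι → V)] A) (hg : g ≠ 1) :
    ∃ e : MulAut ((ι → V) ⋊[MulDistribMulAction.toMulAut A (ι → V)] A),
      ∀ (x : (ι → V) ⋊[MulDistribMulAction.toMulAut A (ι → V)] A) (k : ℕ),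
        e g ≠ x * g ^ k * x⁻¹ := by
  classical
  have : Finite ((ι → V) ⋊[MulDistribMulAction.toMulAut A (ι → V)] A) :=
    Finite.of_equiv _ SemidirectProduct.equivProd.symm
  have hcard := (Nat.mul_le_mul_left (Nat.card A) (orderOf_semidirect_pi_le g)).trans_lt hι
  by_cases ha : g.right = 1
  · have hl : g.left ≠ 1 := fun h ↦ hg (SemidirectProduct.ext h ha)
    obtain ⟨i, hi⟩ := Function.ne_iff.mp hl
    let T (j : ι) : MulAut (ι → V) := if hij : i ≠ j then piTransvection V hij else 1
    have hT (j : ι) (v : ι → V) : T j v = v * if i ≠ j then Pi.mulSingle j (v i) else 1 := by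
      by_cases hij : i ≠ j
      · simp only [T, dif_pos hij, if_pos hij]; rfl
      · simp only [T, dif_neg hij, if_neg hij, mul_one]; rfl
    have hcomm (j : ι) (a : A) (v : ι → V) : T j (a • v) = a • T j v := by
      rw [hT, hT, smul_mul']
      split_ifs
      · rw [smul_mulSingle_apply, Pi.smul_apply]
      · rw [smul_one]
    refine Exists.elim (exists_ne_conj_pow SemidirectProduct.rightHom g
      (fun j ↦ SemidirectProduct.congr (T j) (MulEquiv.refl A) fun a ↦ by
        ext1 v; exact hcomm j a v) hcard ?_) fun _ hj ↦ ⟨_, hj⟩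
    · intro j k n hn h
      have hn' : n.right = 1 := hn
      have h := congrArg SemidirectProduct.left h
      simp only [SemidirectProduct.mul_left, SemidirectProduct.mul_right,
        SemidirectProduct.inv_left, SemidirectProduct.congr_apply_left,
        SemidirectProduct.congr_apply_right, ha, hn', map_one, MulAut.one_apply, inv_one,
        mul_one, mul_inv_cancel_comm, hT, mul_right_inj] at h
      by_contra hjk
      by_cases hij : i = j
      · have hik : i ≠ k := hij ▸ hjk
        have := congrFun h k
        simp only [hij, ne_eq, not_true_eq_false, if_false, hjk, not_false_eq_true, if_true,
          Pi.one_apply, Pi.mulSingle_eq_same] at this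
        exact hi (hij ▸ this.symm)
      · have := congrFun h j
        rw [if_pos hij] at this
        split_ifs at this
        · rw [Pi.mulSingle_eq_same, Pi.mulSingle_eq_of_ne hjk] at this
          exact hi this
        · rw [Pi.mulSingle_eq_same] at this
          exact hi this
  · refine Exists.elim (exists_ne_conj_pow SemidirectProduct.rightHom g
      (fun j : ι ↦ SemidirectProduct.crossedShift (fun a ↦ Pi.mulSingle j (δ a)) fun a b ↦ by
        rw [hδ, Pi.mulSingle_mul, MulDistribMulAction.toMulAut_apply,
          MulDistribMulAction.toMulEquiv_apply, smul_mulSingle_apply]) hcard ?_) fun _ hj ↦ ⟨_, hj⟩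
    · intro j k n hn h
      have hn' : n.right = 1 := hn
      by_contra hjk
      have h := congrFun (congrArg SemidirectProduct.left h) j
      simp only [SemidirectProduct.crossedShift, MulEquiv.coe_mk, Equiv.coe_fn_mk,
        SemidirectProduct.mul_left, SemidirectProduct.mul_right, SemidirectProduct.inv_left,
        hn', map_one, MulAut.one_apply, inv_one, one_mul, MulDistribMulAction.toMulAut_apply,
        MulDistribMulAction.toMulEquiv_apply, Pi.mul_apply, Pi.smul_apply, Pi.inv_apply,
        Pi.mulSingle_eq_same, Pi.mulSingle_eq_of_ne hjk, mul_one] at h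
      refine hδ_ne _ ha (n.left j)⁻¹ (mul_left_cancel (a := g.left j) (h.trans ?_))
      rw [div_inv_eq_mul, mul_comm (n.left j), mul_assoc, mul_comm (n.left j)]

end

section

variable (A M : Type*) [Group A] [Fintype A] [CommGroup M]

/-- The functions `A → M` with product `1`. -/
def augmentationKer : Subgroup (A → M) where
  carrier := {f | ∏ x, f x = 1}
  mul_mem' hf hg := by
    simp only [Set.mem_ofPred_eq] at hf hg ⊢
    simp [Finset.prod_mul_distrib, hf, hg]
  one_mem' := by simp
  inv_mem' hf := by
    simp only [Set.mem_ofPred_eq] at hf ⊢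
    simp [hf]

/-- The action of `A` on `augmentationKer A M` by right translation of the argument. -/
instance : MulDistribMulAction A (augmentationKer A M) where
  smul a f := ⟨fun x ↦ f.1 (x * a),
    (Fintype.prod_equiv (Equiv.mulRight a) _ _ fun _ ↦ rfl).trans f.2⟩
  one_smul f := Subtype.ext <| funext fun x ↦ congrArg f.1 (mul_one x)
  mul_smul a b f := Subtype.ext <| funext fun x ↦ congrArg f.1 (mul_assoc x a b).symm
  smul_mul _ _ _ := rfl
  smul_one _ := rfl

variable {A M}

theorem augmentationKer_smul_apply (a : A) (f : augmentationKer A M) (x : A) :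
    (a • f).1 x = f.1 (x * a) := rfl

theorem exists_prod_eq_pow_orderOf (a : A) (u : A → M) (hu : ∀ x, u (x * a) = u x) :
    ∃ y, ∏ x, u x = y ^ orderOf a := by
  classical
  obtain ⟨S, hS, -⟩ := Subgroup.exists_isComplement_left (Subgroup.zpowers a) 1
  have hpow (x : A) (n : ℕ) : u (x * a ^ n) = u x := by
    induction n with
    | zero => simp
    | succ n ih => rw [pow_succ, ← mul_assoc, hu, ih]
  refine ⟨∏ s : S, u s, ?_⟩
  rw [← Fintype.prod_bijective _ hS (fun p ↦ u p.1) u, Fintype.prod_prod_type]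
  · simp [Finset.prod_pow, Fintype.card_zpowers]
  · rintro ⟨s, h, hh⟩
    obtain ⟨n, rfl⟩ := mem_powers_iff_mem_zpowers.mpr hh
    exact (hpow _ _).symm

variable [DecidableEq A]

/-- The crossed homomorphism from `A` to the augmentation kernel which becomes principal, generated
by the function supported at `1` with value `z`, in the module of all functions. -/
def augmentationCocycle (z : M) (a : A) : augmentationKer A M :=
  ⟨fun x ↦ (Pi.mulSingle 1 z : A → M) (x * a) / (Pi.mulSingle 1 z : A → M) x, by
    change ∏ x, _ / _ = 1
    rw [Finset.prod_div_distrib, div_eq_one]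
    exact Fintype.prod_equiv (Equiv.mulRight a) _ _ fun _ ↦ rfl⟩

theorem augmentationCocycle_mul (z : M) (a b : A) :
    augmentationCocycle z (a * b) = augmentationCocycle z a * a • augmentationCocycle z b := by
  ext x
  simp only [Subgroup.coe_mul, Pi.mul_apply, augmentationKer_smul_apply]
  simp only [augmentationCocycle, mul_assoc]
  rw [mul_comm, div_mul_div_cancel]

theorem augmentationCocycle_ne {z : M} (hz : orderOf z = Nat.card A)
    (hM : ∀ y : M, y ^ Nat.card A = 1) (a : A) (ha : a ≠ 1) (v : augmentationKer A M) :
    augmentationCocycle z a ≠ a • v / v := by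
  intro h
  obtain ⟨y, hy⟩ := exists_prod_eq_pow_orderOf a (fun x ↦ (Pi.mulSingle 1 z : A → M) x / v.1 x)
    fun x ↦ by
      have h := congrFun (congrArg Subtype.val h) x
      simp only [augmentationCocycle, Subgroup.coe_div, Pi.div_apply,
        augmentationKer_smul_apply] at h
      rwa [div_eq_div_iff_div_eq_div]
  have hv : ∏ x, v.1 x = 1 := v.2
  rw [Finset.prod_div_distrib, hv, div_one, Finset.prod_pi_mulSingle'] at hy
  simp only [Finset.mem_univ, if_true] at hy
  obtain ⟨m, hm⟩ := orderOf_dvd_natCard a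
  have hpos : 0 < Nat.card A := Nat.card_pos
  have hzm : z ^ m = 1 := by rw [hy, ← pow_mul, ← hm, hM]
  have hdvd := orderOf_dvd_of_pow_eq_one hzm
  have hm0 : 0 < m := Nat.pos_of_ne_zero fun h ↦ by simp [h] at hm
  have hle := Nat.le_of_dvd hm0 hdvd
  rw [hz, hm] at hle
  have : orderOf a ≤ 1 := Nat.le_of_mul_le_mul_right (by simpa using hle) hm0
  have h1 : 0 < orderOf a := orderOf_pos a
  exact ha (orderOf_eq_one_iff.mp (by omega))

end

/-- For any finite group `A` there is a finite group `G = H ⋊ A` (`H` solvable normal,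
complemented by a subgroup isomorphic to `A`) possessing no characteristic conjugacy
class of nontrivial cyclic subgroups. -/
theorem stmt_1 (A : Type) [Group A] [Finite A] :
    ∃ (G : Type) (_ : Group G) (_ : Finite G) (H K : Subgroup G),
      H.Normal ∧ IsSolvable H ∧ H.IsComplement' K ∧ Nonempty (K ≃* A) ∧
      ∀ C : Subgroup G, C ≠ ⊥ → IsCyclic C →
        ∃ e : MulAut G, ∀ g : G,
          C.map e.toMonoidHom ≠ C.map (MulAut.conj g).toMonoidHom := by
  classical
  have := Fintype.ofFinite A
  let M := Multiplicative (ZMod (Nat.card A))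
  let V := augmentationKer A M
  let ι := Fin (Nat.card A * (Nat.card A * Nat.card V) + 1)
  let φ := MulDistribMulAction.toMulAut A (ι → V)
  have hz : orderOf (Multiplicative.ofAdd (1 : ZMod (Nat.card A))) = Nat.card A := by
    rw [orderOf_ofAdd_eq_addOrderOf, ZMod.addOrderOf_one]
  have hM (y : M) : y ^ Nat.card A = 1 := by
    have := pow_card_eq_one' (x := y)
    rwa [Nat.card_congr Multiplicative.toAdd, Nat.card_zmod] at this
  have : Finite M := inferInstanceAs (Finite (ZMod (Nat.card A)))
  refine ⟨(ι → V) ⋊[φ] A, inferInstance, Finite.of_equiv _ SemidirectProduct.equivProd.symm,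
    SemidirectProduct.inl.range, SemidirectProduct.inr.range, ?_, ?_, ?_, ?_, ?_⟩
  · rw [SemidirectProduct.range_inl_eq_ker_rightHom]
    infer_instance
  · exact Group.isSolvable_of_surjective (SemidirectProduct.inl (φ := φ)).rangeRestrict_surjective
  · refine Subgroup.isComplement'_of_disjoint_and_mul_eq_univ ?_ ?_
    · rw [Subgroup.disjoint_def]
      rintro _ ⟨n, rfl⟩ ⟨a, ha⟩
      have := congrArg SemidirectProduct.left ha
      simp only [SemidirectProduct.left_inr, SemidirectProduct.left_inl] at this
      rw [← this, map_one]
    · refine Set.eq_univ_of_forall fun g ↦ ?_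
      exact ⟨_, ⟨g.left, rfl⟩, _, ⟨g.right, rfl⟩, SemidirectProduct.inl_left_mul_inr_right g⟩
  · exact ⟨(MonoidHom.ofInjective SemidirectProduct.inr_injective).symm⟩
  · intro C hC hcyc
    obtain ⟨g, rfl⟩ := Subgroup.isCyclic_iff_exists_zpowers_eq_top C |>.mp hcyc
    have : Finite ((ι → V) ⋊[φ] A) := Finite.of_equiv _ SemidirectProduct.equivProd.symm
    obtain ⟨e, he⟩ := exists_aut_ne_conj_pow (ι := ι) (augmentationCocycle (Multiplicative.ofAdd 1))
      (augmentationCocycle_mul _) (augmentationCocycle_ne hz hM) (by rw [Nat.card_fin]; exact Nat.lt_succ_self _) g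
      (fun h ↦ hC (by simp [h]))
    refine ⟨e, fun x h ↦ ?_⟩
    have hmem : e g ∈ (Subgroup.zpowers g).map e.toMonoidHom :=
      ⟨g, Subgroup.mem_zpowers g, rfl⟩
    rw [h] at hmem
    obtain ⟨y, hy, hxy⟩ := hmem
    obtain ⟨k, rfl⟩ := mem_powers_iff_mem_zpowers.mpr hy
    exact he x k hxy.symm
end

section
/- Let (G, D₀, D₁) be a wild ordinary triplet and let M be a subgroup of G such that N_{D₁}(M)·D₀ = D₁ (every D₁-conjugate of M is a D₀-conjugate of M). Then the restricted triplet (M, N_{D₀}(M), N_{D₁}(M)) is a wild ordinary triplet, and N_{D₁}(M)/N_{D₀}(M) is isomorphic to D₁/D₀. -/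
open Pointwise

section OrdinaryTriplet

variable {G D : Type*} [Group G] [Group D]

/-- `D₀` (a subgroup of the acting group `D`) is *ordinary* with respect to the action
`φ : D →* MulAut G` iff every inner automorphism of `G` is realized by an element of
`D₀`. -/
def IsOrdinary (φ : D →* MulAut G) (D₀ : Subgroup D) : Prop :=
  ∀ g : G, ∃ α ∈ D₀, φ α = MulAut.conj g

/-- The triplet `(G, D₀, D)` is *wild* iff for every involution `a` of `G`, the
subgroup `C_D(a) · D₀` (the join of the stabilizer of `a` with the normal subgroup
`D₀`) is proper in `D`. -/
def IsWild (φ : D →* MulAut G) (D₀ : Subgroup D) : Prop :=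
  ∀ a : G, orderOf a = 2 →
    (MulAction.stabilizer (MulAut G) a).comap φ ⊔ D₀ < ⊤

/-- The setwise stabilizer `N_D(M)` of a subgroup `M ≤ G` inside the acting group. -/
def Nstab (φ : D →* MulAut G) (M : Subgroup G) : Subgroup D :=
  (MulAction.stabilizer (MulAut G) M).comap φ

theorem Nstab.map_eq (φ : D →* MulAut G) (M : Subgroup G) (ψ : Nstab φ M) :
    M.map ((φ ψ.1) : G ≃* G).toMonoidHom = M := by
  have h : φ ψ.1 • M = M := ψ.2
  conv_rhs => rw [← h]
  ext x
  simp [Subgroup.pointwise_smul_def, Subgroup.mem_map]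

/-- Restriction of the action of `N_D(M)` to `M`. -/
def restrictHom (φ : D →* MulAut G) (M : Subgroup G) : Nstab φ M →* MulAut M where
  toFun ψ := ((φ ψ.1).subgroupMap M).trans (MulEquiv.subgroupCongr (Nstab.map_eq φ M ψ))
  map_one' := by
    ext x
    show ((φ 1) x.1 : G) = x.1
    simp
  map_mul' ψ₁ ψ₂ := by
    ext x
    show ((φ (ψ₁.1 * ψ₂.1)) x.1 : G) = (φ ψ₁.1) ((φ ψ₂.1) x.1)
    simp

end OrdinaryTriplet

section RestrictedTriplet

variable {G D : Type*} [Group G] [Group D] (φ : D →* MulAut G) (D₀ : Subgroup D)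
  (M : Subgroup G)

@[simp]
theorem coe_restrictHom_apply (ψ : Nstab φ M) (x : M) :
    (restrictHom φ M ψ x : G) = φ ψ.1 x :=
  rfl

variable {φ D₀}

theorem IsOrdinary.restrict (hord : IsOrdinary φ D₀) :
    IsOrdinary (restrictHom φ M) (D₀.subgroupOf (Nstab φ M)) := by
  intro g
  obtain ⟨α, hα, hg⟩ := hord g
  have hαM : α ∈ Nstab φ M := by
    change φ α • M = M
    rw [hg]
    exact Subgroup.conj_smul_eq_self_of_mem g.2
  refine ⟨⟨α, hαM⟩, hα, ?_⟩
  ext x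
  simp [hg]

theorem IsWild.restrict (hwild : IsWild φ D₀) (hM : Nstab φ M ⊔ D₀ = ⊤) :
    IsWild (restrictHom φ M) (D₀.subgroupOf (Nstab φ M)) := by
  intro a ha
  refine lt_top_iff_ne_top.2 fun h => (hwild a (by simpa using ha)).ne ?_
  rw [eq_top_iff, ← hM]
  refine sup_le ?_ le_sup_right
  calc Nstab φ M = (⊤ : Subgroup (Nstab φ M)).map (Nstab φ M).subtype := by
        rw [← MonoidHom.range_eq_map, Subgroup.range_subtype]
    _ ≤ _ := by
      rw [← h, Subgroup.map_sup]
      refine sup_le_sup ?_ ((Subgroup.subgroupOf_map_subtype _ _).trans_le inf_le_left)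
      rintro _ ⟨ψ, hψ, rfl⟩
      exact congrArg Subtype.val (show restrictHom φ M ψ a = a from hψ)

end RestrictedTriplet

/-- The second isomorphism theorem for a subgroup `N` and a normal subgroup `K` that together
generate the whole group. -/
noncomputable def quotientSubgroupOfEquivOfSupEqTop {D : Type*} [Group D] (N K : Subgroup D)
    [K.Normal] (h : N ⊔ K = ⊤) : N ⧸ K.subgroupOf N ≃* D ⧸ K :=
  (QuotientGroup.quotientMulEquivOfEq (by
    rw [← MonoidHom.comap_ker, QuotientGroup.ker_mk']; rfl)).trans
  (QuotientGroup.quotientKerEquivOfSurjective ((QuotientGroup.mk' K).comp N.subtype) (by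
    rw [← MonoidHom.range_eq_top, MonoidHom.range_comp, Subgroup.range_subtype,
      ← Subgroup.map_top_of_surjective _ (QuotientGroup.mk'_surjective K), ← h,
      Subgroup.map_sup]
    simp))

/-- If `(G, D₀, D₁)` is a wild ordinary triplet and `M ≤ G` satisfies
`N_{D₁}(M)·D₀ = D₁`, then `(M, N_{D₀}(M), N_{D₁}(M))` is a wild ordinary triplet and
`N_{D₁}(M)/N_{D₀}(M) ≅ D₁/D₀`. -/
theorem stmt_4 (G D : Type) [Group G] [Finite G] [Group D] [Finite D]
    (D₀ : Subgroup D) [D₀.Normal] (φ : D →* MulAut G)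
    (hord : IsOrdinary φ D₀) (hwild : IsWild φ D₀)
    (M : Subgroup G) (hM : Nstab φ M ⊔ D₀ = ⊤) :
    IsOrdinary (restrictHom φ M) (D₀.subgroupOf (Nstab φ M)) ∧
    IsWild (restrictHom φ M) (D₀.subgroupOf (Nstab φ M)) ∧
    Nonempty ((Nstab φ M ⧸ D₀.subgroupOf (Nstab φ M)) ≃* D ⧸ D₀) := by
  exact ⟨hord.restrict M, hwild.restrict M hM, ⟨quotientSubgroupOfEquivOfSupEqTop _ _ hM⟩⟩
end

section
/- Let (G, D₀, D₁) be an ordinary triplet with |G| = 2k for some odd k. Then (G, D₀, D₁) is not wild. -/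
section OrdinaryTriplet

variable {G D : Type*} [Group G] [Group D]

/-- The homomorphism `D →* MulAut (G ⧸ B)` induced by an action leaving `B`
invariant. -/
def inducedQuotHom (φ : D →* MulAut G) (B : Subgroup G) [B.Normal]
    (hB : ∀ ψ : D, B.map (φ ψ).toMonoidHom = B) : D →* MulAut (G ⧸ B) where
  toFun ψ := QuotientGroup.congr B B (φ ψ) (hB ψ)
  map_one' := by
    ext x
    induction x using QuotientGroup.induction_on with
    | H g => simp [QuotientGroup.congr]
  map_mul' ψ₁ ψ₂ := by
    ext x
    induction x using QuotientGroup.induction_on with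
    | H g => simp [QuotientGroup.congr]

/-- A finite group `K` has a normal 2-complement iff it has a normal subgroup of odd
order whose index is a power of `2`. -/
def HasNormal2Complement (K : Type*) [Group K] : Prop :=
  ∃ H : Subgroup K, H.Normal ∧ Odd (Nat.card H) ∧ ∃ n : ℕ, H.index = 2 ^ n

end OrdinaryTriplet

/-- In a group of order `2k` with `k` odd, any two involutions are conjugate. -/
theorem isConj_of_orderOf_eq_two {G : Type*} [Group G] [Finite G] {k : ℕ} (hk : Odd k)
    (hcard : Nat.card G = 2 * k) {a b : G} (ha : orderOf a = 2) (hb : orderOf b = 2) :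
    IsConj a b := by
  have hfac : (Nat.card G).factorization 2 = 1 := by
    have h0 : k ≠ 0 := hk.pos.ne'
    rw [hcard, Nat.factorization_mul two_ne_zero h0, Finsupp.add_apply,
      Nat.prime_two.factorization_self, Nat.factorization_eq_zero_of_not_dvd hk.not_two_dvd_nat]
  have hzp : ∀ {x : G}, orderOf x = 2 →
      Nat.card (Subgroup.zpowers x) = 2 ^ (Nat.card G).factorization 2 := by
    intro x hx
    rw [Nat.card_zpowers, hx, hfac, pow_one]
  obtain ⟨g, hg⟩ := MulAction.exists_smul_eq G
    (Sylow.ofCard (p := 2) (Subgroup.zpowers a) (hzp ha))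
    (Sylow.ofCard (p := 2) (Subgroup.zpowers b) (hzp hb))
  have hmem : g * a * g⁻¹ ∈ Subgroup.zpowers b := by
    have h : Subgroup.map (MulAut.conj g).toMonoidHom (Subgroup.zpowers a) =
        Subgroup.zpowers b := congrArg Sylow.toSubgroup hg
    rw [← h]
    exact ⟨a, Subgroup.mem_zpowers a, rfl⟩
  have hne : g * a * g⁻¹ ≠ 1 := by
    rw [Ne, conj_eq_one_iff]
    rintro rfl
    simp at ha
  rw [isConj_iff]
  refine ⟨g, ?_⟩
  obtain ⟨n, hn⟩ := Subgroup.mem_zpowers_iff.mp hmem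
  have hb2 : b ^ (2 : ℤ) = 1 := by
    exact_mod_cast hb ▸ pow_orderOf_eq_one b
  rw [← hn] at hne ⊢
  rcases Int.even_or_odd' n with ⟨m, rfl | rfl⟩
  · exact absurd (by rw [zpow_mul, hb2, one_zpow]) hne
  · rw [zpow_add, zpow_mul, hb2, one_zpow, one_mul, zpow_one]

/-- An ordinary triplet `(G, D₀, D₁)` with `|G| = 2k`, `k` odd, is not wild. -/
theorem stmt_6 (G D : Type) [Group G] [Finite G] [Group D] [Finite D]
    (D₀ : Subgroup D) [D₀.Normal] (φ : D →* MulAut G)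
    (hord : IsOrdinary φ D₀)
    (k : ℕ) (hk : Odd k) (hcard : Nat.card G = 2 * k) :
    ¬ IsWild φ D₀ := by
  intro hwild
  obtain ⟨a, ha⟩ := exists_prime_orderOf_dvd_card' (G := G) 2 (hcard ▸ dvd_mul_right 2 k)
  refine (hwild a ha).ne (eq_top_iff.mpr fun ψ _ => ?_)
  obtain ⟨g, hg⟩ := isConj_iff.mp (isConj_of_orderOf_eq_two hk hcard ha
    (((φ ψ).orderOf_eq a).trans ha))
  obtain ⟨α, hα, hαg⟩ := hord g
  have hstab : α⁻¹ * ψ ∈ (MulAction.stabilizer (MulAut G) a).comap φ := by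
    rw [Subgroup.mem_comap, MulAction.mem_stabilizer_iff, map_mul, map_inv, mul_smul,
      inv_smul_eq_iff, hαg, MulAut.smul_def, MulAut.smul_def, MulAut.conj_apply, hg]
  rw [← mul_inv_cancel_left α ψ]
  exact mul_mem (Subgroup.mem_sup_right hα) (Subgroup.mem_sup_left hstab)
end

section
/- Let (G, D₀, D₁) be a wild ordinary triplet and B a D₁-invariant subgroup of G of odd order. Then the induced ordinary triplet (G/B, D₀, D₁) is wild. -/
/-- Two elements of square one whose product has odd order are conjugate. -/
theorem exists_conj_eq_of_odd_orderOf_mul {G : Type*} [Group G] {a b : G}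
    (ha : a * a = 1) (hb : b * b = 1) (h : Odd (orderOf (a * b))) :
    ∃ g : G, g * a * g⁻¹ = b := by
  obtain ⟨k, hk⟩ := h
  have hpow : (a * b) ^ (2 * k + 1) = 1 := hk ▸ pow_orderOf_eq_one (a * b)
  have hinv : (a * b)⁻¹ = b * a := by
    rw [mul_inv_rev, inv_eq_of_mul_eq_one_left ha, inv_eq_of_mul_eq_one_left hb]
  have hsemi : SemiconjBy a (a * b)⁻¹ (a * b) := by
    rw [hinv, SemiconjBy]; group
  have hcomm : a * ((a * b)⁻¹) ^ k = (a * b) ^ k * a := hsemi.pow_right k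
  refine ⟨(a * b) ^ k, ?_⟩
  calc (a * b) ^ k * a * ((a * b) ^ k)⁻¹
      = a * ((a * b) ^ (2 * k))⁻¹ := by
        rw [← hcomm, inv_pow, mul_assoc, ← mul_inv_rev, ← pow_add, two_mul]
    _ = a * (a * b) := by
        rw [inv_eq_of_mul_eq_one_right (by rw [← pow_succ, hpow])]
    _ = b := by rw [← mul_assoc, ha, one_mul]

/-- An involution of the quotient by a normal subgroup of odd order lifts to an involution. -/
theorem exists_orderOf_eq_two_mk_eq {G : Type*} [Group G] (B : Subgroup G) [B.Normal]
    (hodd : Odd (Nat.card B)) {x : G ⧸ B} (hx : orderOf x = 2) :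
    ∃ a : G, orderOf a = 2 ∧ (a : G ⧸ B) = x := by
  obtain ⟨g, rfl⟩ := QuotientGroup.mk_surjective x
  have hxx : (g : G ⧸ B) ^ 2 = 1 := hx ▸ pow_orderOf_eq_one (g : G ⧸ B)
  have hcoe : ((g ^ Nat.card B : G) : G ⧸ B) = g := by
    obtain ⟨k, hk⟩ := hodd
    rw [QuotientGroup.mk_pow, hk, pow_succ, pow_mul, hxx, one_pow, one_mul]
  refine ⟨g ^ Nat.card B, orderOf_eq_prime ?_ ?_, hcoe⟩
  · have hmem : g ^ 2 ∈ B := by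
      rwa [← QuotientGroup.eq_one_iff, QuotientGroup.mk_pow]
    rw [← pow_mul, mul_comm, pow_mul]
    exact orderOf_dvd_iff_pow_eq_one.mp (B.orderOf_dvd_natCard hmem)
  · intro h
    rw [h, QuotientGroup.mk_one] at hcoe
    rw [← hcoe, orderOf_one] at hx
    omega

/-- If `(G, D₀, D₁)` is a wild ordinary triplet and `B` is a `D₁`-invariant subgroup
of odd order, then the induced triplet `(G/B, D₀, D₁)` is wild. -/
theorem stmt_7 (G D : Type) [Group G] [Finite G] [Group D] [Finite D]
    (D₀ : Subgroup D) [D₀.Normal] (φ : D →* MulAut G)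
    (hord : IsOrdinary φ D₀) (hwild : IsWild φ D₀)
    (B : Subgroup G) [B.Normal] (hB : ∀ ψ : D, B.map (φ ψ).toMonoidHom = B)
    (hodd : Odd (Nat.card B)) :
    IsWild (inducedQuotHom φ B hB) D₀ := by
  intro x hx
  obtain ⟨a, ha, rfl⟩ := exists_orderOf_eq_two_mk_eq B hodd hx
  refine lt_of_le_of_lt (sup_le (fun ψ hψ => ?_) le_sup_right) (hwild a ha)
  have haa : a * a = 1 := by rw [← pow_two, ← ha, pow_orderOf_eq_one]
  have hbb : φ ψ a * φ ψ a = 1 := by rw [← map_mul, haa, map_one]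
  have hcoset : ((φ ψ a : G) : G ⧸ B) = a := hψ
  have hmem : a * φ ψ a ∈ B := by
    rw [← QuotientGroup.eq_one_iff, QuotientGroup.mk_mul, hcoset, ← QuotientGroup.mk_mul, haa,
      QuotientGroup.mk_one]
  obtain ⟨g, hg⟩ := exists_conj_eq_of_odd_orderOf_mul haa hbb
    (hodd.of_dvd_nat (Subgroup.orderOf_dvd_natCard B hmem))
  obtain ⟨α, hα, hαg⟩ := hord g
  have hfix : α⁻¹ * ψ ∈ (MulAction.stabilizer (MulAut G) a).comap φ := by
    rw [Subgroup.mem_comap, MulAction.mem_stabilizer_iff, map_mul, map_inv, hαg, mul_smul,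
      inv_smul_eq_iff]
    exact hg.symm
  rw [← mul_inv_cancel_left α ψ]
  exact mul_mem (Subgroup.mem_sup_right hα) (Subgroup.mem_sup_left hfix)
end

section
/- Let (M, D₀, D₁) be an ordinary triplet such that D₁/D₀ has a normal 2-complement and M is a 2-group. Assume there exists a D₁-invariant normal subgroup B of M with [M : B] = 2. Then (M, D₀, D₁) is not wild. -/
section CoprimeAction

variable {T Q Ω : Type*} [Group T] [Group Q]

/-- Averaging: if a finite group `T` acts compatibly on a group `Q` and on a `Q`-set `Ω`, and
stabilizes the orbit of `ω` under a `T`-invariant subgroup `R` of order coprime to that of `T`,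
then it stabilizes some `⁅R, R⁆`-orbit contained in that `R`-orbit. -/
theorem exists_mem_commutator_orbit_of_coprime [Finite T] (φ : T →* MulAut Q)
    (a : T →* Equiv.Perm Ω) (b : Q →* Equiv.Perm Ω)
    (hab : ∀ t q ω, a t (b q ω) = b (φ t q) (a t ω))
    (R : Subgroup Q) [Finite R] (hR : ∀ t, ∀ r ∈ R, φ t r ∈ R)
    (hco : (Nat.card R).Coprime (Nat.card T)) (ω : Ω)
    (hω : ∀ t, ∃ r ∈ R, a t ω = b r ω) :
    ∃ x ∈ R, ∀ t, ∃ c ∈ ⁅R, R⁆, a t (b x ω) = b c (b x ω) := by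
  classical
  have := Fintype.ofFinite T
  let S : Subgroup R :=
    (MulAction.stabilizer (Equiv.Perm Ω) ω).comap (b.comp R.subtype)
  have hS : ∀ σ : R, σ ∈ S ↔ b σ ω = ω := fun σ => Iff.rfl
  let A := Abelianization R ⧸ S.map Abelianization.of
  let π : R →* A := (QuotientGroup.mk' (S.map Abelianization.of)).comp Abelianization.of
  let ρ : T → R →* R := fun t =>
    ((φ t).toMonoidHom.comp R.subtype).codRestrict R (fun r => hR t r r.2)
  have hρ : ∀ t r, ((ρ t r : R) : Q) = φ t r := fun t r => rfl
  have hπS : ∀ σ ∈ S, π σ = 1 := fun σ hσ =>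
    (QuotientGroup.eq_one_iff _).2 (Subgroup.mem_map_of_mem _ hσ)
  have hπ : ∀ x y : R, π x = π y → ∃ c ∈ ⁅R, R⁆, b y ω = b c (b x ω) := by
    intro x y hxy
    obtain ⟨σ, hσ, h⟩ := QuotientGroup.eq.1 hxy
    have hd : x⁻¹ * y * σ⁻¹ ∈ commutator R := by
      rw [← Abelianization.ker_of, MonoidHom.mem_ker]
      simp [h]
    have hd' : y * σ⁻¹ * x⁻¹ ∈ commutator R := by
      have := (inferInstance : (commutator R).Normal).conj_mem _ hd x
      simpa [mul_assoc] using this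
    refine ⟨(y * σ⁻¹ * x⁻¹ : R), ?_, ?_⟩
    · rw [← Subgroup.map_subtype_commutator]
      exact Subgroup.mem_map_of_mem _ hd'
    · have := (hS _).1 (S.inv_mem hσ)
      simp only [Subgroup.coe_mul, Subgroup.coe_inv] at this ⊢
      rw [← Equiv.Perm.mul_apply, ← map_mul, inv_mul_cancel_right, map_mul,
        Equiv.Perm.mul_apply, this]
  choose r hrR hr using hω
  let r' : T → R := fun t => ⟨r t, hrR t⟩
  have hcoc : ∀ s t, π (r' (s * t)) = π (ρ s (r' t)) * π (r' s) := by
    intro s t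
    have h : (r' (s * t))⁻¹ * (ρ s (r' t) * r' s) ∈ S := by
      rw [hS]
      simp only [Subgroup.coe_mul, Subgroup.coe_inv, hρ, map_mul, Equiv.Perm.mul_apply, r']
      rw [← hr, ← hab, ← hr, ← Equiv.Perm.mul_apply (a s), ← map_mul, hr, map_inv,
        Equiv.Perm.inv_def, Equiv.symm_apply_apply]
    have := hπS _ h
    rw [map_mul, map_inv, inv_mul_eq_one, map_mul] at this
    exact this
  let P : R := ((Finset.univ : Finset T).toList.map r').prod
  have hP : ∀ f : R →* A, f P = ∏ t, f (r' t) := by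
    intro f
    rw [map_list_prod, List.map_map, ← Finset.prod_map_toList]
    rfl
  have hPs : ∀ s, π P = π (ρ s P) * π (r' s) ^ Nat.card T := by
    intro s
    rw [hP, ← MonoidHom.comp_apply, hP, ← Equiv.prod_comp (Equiv.mulLeft s)]
    simp only [Equiv.coe_mulLeft, hcoc, Finset.prod_mul_distrib, MonoidHom.comp_apply]
    simp
  obtain ⟨x, hx⟩ := (powCoprime hco).surjective P
  rw [powCoprime_apply] at hx
  have hcoA : (Nat.card A).Coprime (Nat.card T) :=
    hco.coprime_dvd_left (Subgroup.card_dvd_of_surjective π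
      ((QuotientGroup.mk'_surjective _).comp QuotientGroup.mk_surjective))
  have hxs : ∀ s, π x = π (ρ s x * r' s) := by
    intro s
    apply (powCoprime hcoA).injective
    simp only [powCoprime_apply, map_mul, mul_pow]
    simp only [← map_pow, hx]
    rw [hPs s, map_pow]
  refine ⟨x, x.2, fun t => ?_⟩
  obtain ⟨c, hc, h⟩ := hπ _ _ (hxs t)
  refine ⟨c, hc, ?_⟩
  rw [hab, hr, ← h, Subgroup.coe_mul, map_mul, hρ]
  rfl

/-- A form of Glauberman's lemma: a finite group `T` acting compatibly on a solvable group `Q`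
and on a `Q`-set fixes a point of every orbit it stabilizes of a `T`-invariant subgroup of order
coprime to that of `T`. -/
theorem exists_mem_orbit_fixed_of_coprime [Finite T] [Finite Q] [Group.IsSolvable Q]
    (φ : T →* MulAut Q) (a : T →* Equiv.Perm Ω) (b : Q →* Equiv.Perm Ω)
    (hab : ∀ t q ω, a t (b q ω) = b (φ t q) (a t ω))
    (R : Subgroup Q) (hR : ∀ t, ∀ r ∈ R, φ t r ∈ R)
    (hco : (Nat.card R).Coprime (Nat.card T)) (ω : Ω)
    (hω : ∀ t, ∃ r ∈ R, a t ω = b r ω) :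
    ∃ x ∈ R, ∀ t, a t (b x ω) = b x ω := by
  induction R using WellFoundedLT.induction generalizing ω with
  | ind R ih =>
    rcases eq_or_ne R ⊥ with rfl | hne
    · refine ⟨1, Subgroup.one_mem _, fun t => ?_⟩
      obtain ⟨r, hr, h⟩ := hω t
      simpa [Subgroup.mem_bot.1 hr] using h
    · obtain ⟨x, hx, h⟩ := exists_mem_commutator_orbit_of_coprime φ a b hab R hR hco ω hω
      have hlt := Group.IsSolvable.commutator_lt_of_ne_bot hne
      obtain ⟨y, hy, h'⟩ := ih ⁅R, R⁆ hlt
        (fun t r hr => by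
          have : (⁅R, R⁆).map (φ t).toMonoidHom ≤ ⁅R, R⁆ := by
            have hle : R.map (φ t).toMonoidHom ≤ R := Subgroup.map_le_iff_le_comap.2 (hR t)
            rw [Subgroup.map_commutator]
            exact Subgroup.commutator_mono hle hle
          exact this (Subgroup.mem_map_of_mem _ hr))
        (hco.coprime_dvd_left (Subgroup.card_dvd_of_le hlt.le)) (b x ω) h
      refine ⟨y * x, R.mul_mem (hlt.le hy) hx, fun t => ?_⟩
      rw [map_mul]
      exact h' t

/-- A finite group of odd order acting on a finite `2`-group and leaving a subgroup of index `2`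
invariant fixes an element outside that subgroup. -/
theorem exists_fixed_notMem_of_index_two [Finite T] {M : Type*} [Group M] [Finite M]
    (h2 : IsPGroup 2 M) (hT : Odd (Nat.card T)) (φ : T →* MulAut M) (B : Subgroup M)
    (hB : ∀ t, ∀ m ∈ B, φ t m ∈ B) (hidx : B.index = 2) :
    ∃ m ∉ B, ∀ t, φ t m = m := by
  have hsol : Group.IsSolvable M := by
    have := h2.isNilpotent
    infer_instance
  obtain ⟨w, hw⟩ : ∃ w, w ∉ B := by
    by_contra! h
    have : B = ⊤ := (Subgroup.eq_top_iff' B).2 h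
    simp [this] at hidx
  have hco : (Nat.card B).Coprime (Nat.card T) := by
    obtain ⟨n, hn⟩ := (h2.to_subgroup B).exists_card_eq
    rw [hn]
    exact Nat.Coprime.pow_left _ (Nat.coprime_two_left.2 hT)
  have hw' : ∀ t, φ t w ∉ B := fun t h => hw (by
    have := hB t⁻¹ _ h
    simpa using this)
  obtain ⟨x, hx, h⟩ := exists_mem_orbit_fixed_of_coprime φ ((MulAut.toPerm M).comp φ)
    (MulAction.toPermHom M M)
    (fun t q ω => map_mul (φ t) q ω) B hB hco w
    (fun t => ⟨φ t w * w⁻¹, (Subgroup.mul_mem_iff_of_index_two hidx).2 (by simp [hw, hw' t]),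
      (inv_mul_cancel_right (φ t w) w).symm⟩)
  refine ⟨x * w, fun h => hw ((B.mul_mem_cancel_left hx).1 h), h⟩

end CoprimeAction

section Frattini

variable {N : Type*} [Group N] [Finite N]

/-- Frattini argument for complements: if the normal subgroup `Q` is solvable, `T` has order
coprime to that of `Q`, and `Q ⊔ T` is normal, then `Q` and the normalizer of `T` generate. -/
theorem sup_normalizer_eq_top_of_coprime (Q T : Subgroup N) [Q.Normal] [Group.IsSolvable Q]
    [(Q ⊔ T).Normal] (hco : (Nat.card Q).Coprime (Nat.card T)) :
    Q ⊔ Subgroup.normalizer (T : Set N) = ⊤ := by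
  rw [Subgroup.eq_top_iff']
  intro g
  let c : T →* N := (MulAut.conj g).toMonoidHom.comp T.subtype
  have hc : ∀ t : T, c t = g * t * g⁻¹ := fun t => rfl
  obtain ⟨q, -, hq⟩ := exists_mem_orbit_fixed_of_coprime (Ω := N ⧸ T)
    ((MulAut.conjNormal (H := Q)).comp c) ((MulAction.toPermHom N (N ⧸ T)).comp c)
    ((MulAction.toPermHom N (N ⧸ T)).comp Q.subtype)
    (fun t q ω => by simp [smul_smul]) ⊤ (by simp)
    (by rwa [Subgroup.card_top]) ((1 : N) : N ⧸ T)
    (fun t => by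
      have ht : c t ∈ Q ⊔ T := Subgroup.Normal.conj_mem inferInstance _
        (Subgroup.mem_sup_right t.2) g
      obtain ⟨q, hq, s, hs, h⟩ := Subgroup.mem_sup_of_normal_left.1 ht
      refine ⟨⟨q, hq⟩, trivial, ?_⟩
      simp only [MonoidHom.comp_apply, MulAction.toPermHom_apply, MulAction.toPerm_apply,
        MulAction.Quotient.smul_coe, smul_eq_mul, mul_one, Subgroup.subtype_apply]
      rw [← h, eq_comm, QuotientGroup.eq]
      simpa using hs)
  have hn : (q : N)⁻¹ * g ∈ Subgroup.normalizer (T : Set N) := by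
    rw [Subgroup.mem_normalizer_iff_map_conj_eq]
    refine Subgroup.eq_of_le_of_card_ge ?_ ?_
    · rintro _ ⟨t, ht, rfl⟩
      have := hq ⟨t, ht⟩
      simp only [MonoidHom.comp_apply, MulAction.toPermHom_apply, MulAction.toPerm_apply,
        MulAction.Quotient.smul_coe, smul_eq_mul, mul_one, Subgroup.subtype_apply, hc] at this
      rw [eq_comm, QuotientGroup.eq] at this
      simpa [mul_assoc] using this
    · exact (Subgroup.card_map_of_injective (MulEquiv.injective _)).ge
  have := Subgroup.mul_mem_sup q.2 hn
  simpa using this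

end Frattini

/-- A finite group `N` with normal subgroups `Q ≤ L`, where `Q` is a `2`-group, `Q` has odd index
in `L` and `N ⧸ L` is a `2`-group, acting on a `2`-group `M` with an invariant subgroup of index
`2`: some involution of `M` has a stabilizer supplementing `Q`. -/
theorem exists_involution_stabilizer_sup_eq_top {M N : Type*} [Group M] [Finite M] [Group N]
    [Finite N] (φ : N →* MulAut M) (h2 : IsPGroup 2 M) (B : Subgroup M)
    (hB : ∀ n, ∀ m ∈ B, φ n m ∈ B) (hidx : B.index = 2)
    (Q L : Subgroup N) [Q.Normal] [L.Normal] (hQ : IsPGroup 2 Q) (hQL : Q ≤ L)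
    (hodd : Odd (Q.relIndex L)) (hL : IsPGroup 2 (N ⧸ L)) :
    ∃ a : M, orderOf a = 2 ∧ (MulAction.stabilizer (MulAut M) a).comap φ ⊔ Q = ⊤ := by
  have hQsol : Group.IsSolvable Q := by
    have := hQ.isNilpotent
    infer_instance
  have hcop : (Nat.card Q).Coprime (Q.relIndex L) := by
    obtain ⟨n, hn⟩ := hQ.exists_card_eq
    rw [hn]
    exact Nat.Coprime.pow_left _ (Nat.coprime_two_left.2 hodd)
  have hcardQ : Nat.card (Q.subgroupOf L) = Nat.card Q :=
    Nat.card_congr (Subgroup.subgroupOfEquivOfLe hQL).toEquiv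
  obtain ⟨T', hT'⟩ := Subgroup.exists_right_complement'_of_coprime (N := Q.subgroupOf L)
    (by rw [hcardQ]; exact hcop)
  obtain ⟨T, hTdef⟩ : ∃ T, T = T'.map L.subtype := ⟨_, rfl⟩
  have hTcard : Nat.card T = Q.relIndex L := by
    rw [hTdef, Subgroup.card_map_of_injective L.subtype_injective]
    exact hT'.symm.index_eq_card.symm
  have hsup : Q ⊔ T = L := by
    have := congrArg (Subgroup.map L.subtype) hT'.sup_eq_top
    rwa [Subgroup.map_sup, Subgroup.map_subgroupOf_eq_of_le hQL, ← hTdef,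
      ← MonoidHom.range_eq_map, Subgroup.range_subtype] at this
  have : (Q ⊔ T).Normal := hsup ▸ inferInstance
  have hfrat := sup_normalizer_eq_top_of_coprime Q T (hTcard ▸ hcop)
  obtain ⟨m, hmB, hm⟩ := exists_fixed_notMem_of_index_two h2 (hTcard ▸ hodd)
    (φ.comp T.subtype) B (fun t => hB t) hidx
  let Y := Subgroup.normalizer (T : Set N)
  let S : Sylow 2 Y := default
  let C : Subgroup M :=
    { carrier := {x | ∀ t ∈ T, φ t x = x}
      mul_mem' := fun hx hy t ht => by rw [map_mul, hx t ht, hy t ht]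
      one_mem' := fun t _ => map_one _
      inv_mem' := fun hx t ht => by rw [map_inv, hx t ht] }
  have hYC : ∀ y : Y, ∀ x ∈ C, φ y x ∈ C := by
    intro y x hx t ht
    have h := hx _ ((Subgroup.mem_normalizer_iff''.1 y.2 t).1 ht)
    rw [map_mul, map_mul, MulAut.mul_apply, MulAut.mul_apply, map_inv] at h
    simpa using congrArg (φ y) h
  let _ : MulAction S C :=
    { smul := fun s x => ⟨φ (s : Y) x, hYC s x x.2⟩
      one_smul := fun x => Subtype.ext (by change φ ((1 : S) : Y) x = x; simp)
      mul_smul := fun s t x => Subtype.ext (by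
        change φ ((s * t : S) : Y) x = φ (s : Y) (φ (t : Y) x); simp) }
  have hCcard : 2 ∣ Nat.card C := by
    obtain ⟨n, hn⟩ := (h2.to_subgroup C).exists_card_eq
    rw [hn]
    refine dvd_pow_self 2 ?_
    rintro rfl
    rw [pow_zero, Subgroup.card_eq_one] at hn
    have hmC : m ∈ C := fun t ht => hm ⟨t, ht⟩
    rw [hn, Subgroup.mem_bot] at hmC
    exact hmB (hmC ▸ B.one_mem)
  obtain ⟨c, hc, hc1⟩ := S.isPGroup'.exists_fixed_point_of_prime_dvd_card_of_fixed_point C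
    hCcard (a := 1) (fun s => Subtype.ext (map_one (φ (s : Y))))
  have hcS : ∀ s : S, φ (s : Y) c = c := fun s => congrArg Subtype.val (hc s)
  have hne : (c : M) ≠ 1 := fun h => hc1 (Subtype.ext h.symm)
  obtain ⟨k, hk⟩ : ∃ k, orderOf ((c : M) ^ k) = 2 := by
    obtain ⟨n, hn⟩ := IsPGroup.iff_orderOf.1 h2 c
    have hn0 : n ≠ 0 := by
      rintro rfl
      exact hne (orderOf_eq_one_iff.1 (by simpa using hn))
    obtain ⟨j, rfl⟩ := Nat.exists_eq_succ_of_ne_zero hn0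
    exact ⟨2 ^ j, by
      rw [orderOf_pow_of_dvd (by positivity) (hn ▸ pow_dvd_pow 2 (Nat.le_succ j)), hn, pow_succ,
        Nat.mul_div_cancel_left _ (by positivity)]⟩
  refine ⟨(c : M) ^ k, hk, ?_⟩
  set W := (MulAction.stabilizer (MulAut M) ((c : M) ^ k)).comap φ ⊔ Q
  have hstab : ∀ n, φ n c = c → n ∈ W := fun n hn => Subgroup.mem_sup_left (by
    change φ n ((c : M) ^ k) = (c : M) ^ k
    rw [map_pow, hn])
  have hLW : L ≤ W := by
    rw [← hsup]
    exact sup_le le_sup_right fun t ht => hstab t (c.2 t ht)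
  have hf : Function.Surjective ((QuotientGroup.mk' L).comp Y.subtype) := by
    intro x
    obtain ⟨g, rfl⟩ := QuotientGroup.mk'_surjective L x
    obtain ⟨q, hq, y, hy, rfl⟩ := Subgroup.mem_sup_of_normal_left.1
      (hfrat ▸ Subgroup.mem_top g : g ∈ Q ⊔ Y)
    refine ⟨⟨y, hy⟩, ?_⟩
    have : QuotientGroup.mk' L q = 1 := (QuotientGroup.eq_one_iff q).2 (hQL hq)
    rw [map_mul, this, one_mul]
    rfl
  have hSmap : (S : Subgroup Y).map ((QuotientGroup.mk' L).comp Y.subtype) = ⊤ := by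
    rw [← Sylow.coe_mapSurjective hf S]
    exact ((S.mapSurjective hf).is_maximal' (hL.of_equiv Subgroup.topEquiv.symm) le_top).symm
  rw [Subgroup.eq_top_iff']
  intro g
  obtain ⟨s, hs, h⟩ := (hSmap ▸ Subgroup.mem_top (QuotientGroup.mk' L g) :
    QuotientGroup.mk' L g ∈ (S : Subgroup Y).map ((QuotientGroup.mk' L).comp Y.subtype))
  have hsW : (s : N) ∈ W := hstab s (hcS ⟨s, hs⟩)
  have := hLW (QuotientGroup.eq.1 h)
  exact (W.mul_mem_cancel_left (W.inv_mem hsW)).1 this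

/-- Let `(M, D₀, D₁)` be an ordinary triplet where `D₁/D₀` has a normal 2-complement
and `M` is a 2-group. If some `D₁`-invariant normal subgroup `B ⊴ M` has index 2,
then `(M, D₀, D₁)` is not wild. -/
theorem stmt_8 (M D : Type) [Group M] [Finite M] [Group D] [Finite D]
    (D₀ : Subgroup D) [D₀.Normal] (φ : D →* MulAut M)
    (hord : IsOrdinary φ D₀)
    (hcomp : HasNormal2Complement (D ⧸ D₀))
    (h2 : IsPGroup 2 M)
    (B : Subgroup M) (hBn : B.Normal)
    (hB : ∀ ψ : D, B.map (φ ψ).toMonoidHom = B)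
    (hidx : B.index = 2) :
    ¬ IsWild φ D₀ := by
  have hB' : ∀ ψ, ∀ m ∈ B, φ ψ m ∈ B := fun ψ m hm =>
    (hB ψ).le (Subgroup.mem_map_of_mem (φ ψ).toMonoidHom hm)
  obtain ⟨H, hH, hHodd, n, hHidx⟩ := hcomp
  let P : Sylow 2 D₀ := default
  obtain ⟨Q, hQdef⟩ : ∃ Q, Q = (P : Subgroup D₀).map D₀.subtype := ⟨_, rfl⟩
  have hQ2 : IsPGroup 2 Q := hQdef ▸ P.isPGroup'.map _
  have hQD₀ : Q ≤ D₀ := hQdef ▸ Subgroup.map_subtype_le _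
  let N := Subgroup.normalizer (Q : Set D)
  have hND₀ : N ⊔ D₀ = ⊤ := by
    have := P.normalizer_sup_eq_top
    rwa [← hQdef] at this
  let E : Subgroup D := H.comap (QuotientGroup.mk' D₀)
  have hE : E.Normal := hH.comap _
  have hD₀E : D₀ ≤ E := fun x hx => by
    have : QuotientGroup.mk' D₀ x = 1 := (QuotientGroup.eq_one_iff x).2 hx
    rw [Subgroup.mem_comap, this]
    exact H.one_mem
  have hodd : Odd (Q.relIndex E) := by
    rw [← Subgroup.relIndex_mul_relIndex Q D₀ E hQD₀ hD₀E]
    refine Odd.mul ?_ ?_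
    · have hsub : Q.subgroupOf D₀ = P := by
        rw [hQdef]
        exact Subgroup.comap_map_eq_self_of_injective D₀.subtype_injective _
      rw [Subgroup.relIndex, hsub, ← Nat.not_even_iff_odd, even_iff_two_dvd]
      exact P.not_dvd_index
    · have : D₀.relIndex E = Nat.card H := by
        conv_lhs => rw [← QuotientGroup.ker_mk' D₀, ← MonoidHom.comap_bot, Subgroup.relIndex_comap,
          Subgroup.map_comap_eq_self_of_surjective (QuotientGroup.mk'_surjective D₀),
          Subgroup.relIndex_bot_left]
      rwa [this]
  have hQN : Q ≤ N := Subgroup.le_normalizer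
  have : (Q.subgroupOf N).Normal := Subgroup.normal_in_normalizer
  have : (E.subgroupOf N).Normal := Subgroup.normal_subgroupOf
  have hquot : IsPGroup 2 (N ⧸ E.subgroupOf N) := by
    have hdvd : E.relIndex N ∣ 2 ^ n := by
      rw [← hHidx, ← H.index_comap_of_surjective (QuotientGroup.mk'_surjective D₀)]
      exact E.relIndex_dvd_index_of_normal N
    obtain ⟨k, -, hk⟩ := (Nat.dvd_prime_pow Nat.prime_two).1 hdvd
    exact IsPGroup.of_card hk
  obtain ⟨a, ha, htop⟩ := exists_involution_stabilizer_sup_eq_top (φ.comp N.subtype) h2 B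
    (fun x => hB' x) hidx (Q.subgroupOf N) (E.subgroupOf N)
    (hQ2.of_equiv (Subgroup.subgroupOfEquivOfLe hQN).symm)
    (Subgroup.comap_mono (hQD₀.trans hD₀E))
    (by
      rw [← Subgroup.inf_subgroupOf_right E N, Subgroup.relIndex_subgroupOf inf_le_right]
      refine hodd.of_dvd_nat ?_
      rw [← Subgroup.relIndex_mul_relIndex Q (E ⊓ N) E (le_inf (hQD₀.trans hD₀E) hQN) inf_le_left]
      exact dvd_mul_right _ _)
    hquot
  intro hwild
  refine (hwild a ha).ne (top_le_iff.1 ?_)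
  rw [← hND₀]
  refine sup_le ?_ le_sup_right
  have := congrArg (Subgroup.map N.subtype) htop
  rw [Subgroup.map_sup, Subgroup.map_subgroupOf_eq_of_le hQN, ← MonoidHom.range_eq_map,
    Subgroup.range_subtype, ← Subgroup.comap_comap] at this
  rw [← this]
  exact sup_le_sup (Subgroup.map_comap_le _ _) hQD₀
end

section
/- Let (G, D₀, D₁) be a wild ordinary triplet such that D₁/D₀ has a normal 2-complement, and let B be a solvable D₁-invariant subgroup of G. Then the induced ordinary triplet (G/B, D₀, D₁) is wild. -/
open scoped IsMulCommutative in
theorem exists_coboundary_of_coprime {M V : Type*} [Group M] [Finite M] [Group V]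
    [IsMulCommutative V]
    (hcop : (Nat.card V).Coprime (Nat.card M)) (θ : M → V →* V) (f : M → V)
    (hf : ∀ m k, f (m * k) = θ m (f k) * f m) : ∃ v, ∀ m, v = θ m v * f m := by
  have := Fintype.ofFinite M
  obtain ⟨s, hs⟩ : ∃ s, ∀ x : V, (x ^ Nat.card M) ^ s = x := by
    have hmod := Nat.chineseRemainder hcop 1 0
    obtain ⟨k, hk⟩ := (Nat.modEq_zero_iff_dvd.mp hmod.2.2 : Nat.card M ∣ hmod.1)
    refine ⟨k, fun x => ?_⟩
    rw [← pow_mul, ← hk, ← pow_mod_natCard, hmod.2.1, pow_mod_natCard, pow_one]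
  refine ⟨(∏ k, f k) ^ s, fun m => ?_⟩
  have h : ∏ k, f k = θ m (∏ k, f k) * f m ^ Nat.card M := by
    rw [map_prod, ← Equiv.prod_comp (Equiv.mulLeft m) f]
    simp only [Equiv.coe_mulLeft, hf, Finset.prod_mul_distrib, Finset.prod_const,
      Finset.card_univ, Nat.card_eq_fintype_card]
  conv_lhs => rw [h]
  rw [mul_pow, hs, map_pow]

theorem exists_conj_mem_of_coprime {L : Type*} [Group L] [Finite L] {V K K₂ : Subgroup L}
    [V.Normal] [IsMulCommutative V] (hcop : (Nat.card V).Coprime (Nat.card K₂))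
    (hVK : Disjoint V K) (h : K₂ ≤ V ⊔ K) : ∃ v ∈ V, ∀ m ∈ K₂, v⁻¹ * m * v ∈ K := by
  have hdec : ∀ k : K₂, ∃ v : V, (v : L)⁻¹ * k ∈ K := by
    intro k
    obtain ⟨v, hv, r, hr, hk⟩ := Subgroup.mem_sup_of_normal_left.mp (h k.2)
    exact ⟨⟨v, hv⟩, by simpa [← hk] using hr⟩
  choose f hf using hdec
  obtain ⟨v, hv⟩ := exists_coboundary_of_coprime hcop
    (fun m : K₂ => (MulAut.conjNormal (m : L) : V ≃* V).toMonoidHom) f (fun m k => by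
      have hK := K.mul_mem (K.mul_mem (hf (m * k)) (K.inv_mem (hf k))) (K.inv_mem (hf m))
      have hV := ((f (m * k))⁻¹ * (MulAut.conjNormal (m : L) (f k) * f m)).2
      rw [← inv_mul_eq_one, Subtype.ext_iff]
      refine Subgroup.disjoint_def.mp hVK hV ?_
      simpa [MulAut.conjNormal_apply, mul_assoc] using hK)
  refine ⟨v, v.2, fun m hm => ?_⟩
  have h1 := congrArg (Subtype.val) (hv ⟨m, hm⟩)
  have h2 := hf ⟨m, hm⟩
  have h4 : (v : L)⁻¹ * m * v = (f ⟨m, hm⟩ : L)⁻¹ * m := by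
    have h3 : (f ⟨m, hm⟩ : L) = (m * v * m⁻¹)⁻¹ * v := by
      rw [eq_inv_mul_iff_mul_eq]
      exact h1.symm
    rw [h3]
    group
  exact h4 ▸ h2

theorem exists_complement_normalizer_sup_eq_top {L : Type*} [Group L] [Finite L]
    {V M : Subgroup L} [V.Normal] [M.Normal] [IsMulCommutative V] (hVM : V ≤ M)
    (hcop : (Nat.card V).Coprime (V.relIndex M)) :
    ∃ K ≤ M, Nat.card K = V.relIndex M ∧ K.relIndex M = Nat.card V ∧
      Subgroup.normalizer (K : Set L) ⊔ V = ⊤ := by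
  have hcard : Nat.card (V.subgroupOf M) = Nat.card V :=
    Nat.card_congr (Subgroup.subgroupOfEquivOfLe hVM).toEquiv
  obtain ⟨K', hK'⟩ := Subgroup.exists_right_complement'_of_coprime (N := V.subgroupOf M)
    (by rw [hcard]; exact hcop)
  have hKM : K'.map M.subtype ≤ M := Subgroup.map_subtype_le K'
  have hKc : Nat.card (K'.map M.subtype) = V.relIndex M := by
    rw [Subgroup.card_map_of_injective M.subtype_injective, ← hK'.symm.index_eq_card]; rfl
  have hsup : M = V ⊔ K'.map M.subtype := by
    have := congrArg (Subgroup.map M.subtype) hK'.sup_eq_top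
    rw [Subgroup.map_sup, Subgroup.subgroupOf_map_subtype, inf_of_le_left hVM] at this
    rw [this, ← MonoidHom.range_eq_map, M.range_subtype]
  refine ⟨K'.map M.subtype, hKM, hKc, ?_, ?_⟩
  · rw [← hcard, ← hK'.index_eq_card, Subgroup.relIndex, Subgroup.subgroupOf,
      Subgroup.comap_map_eq_self_of_injective M.subtype_injective]
  · set K := K'.map M.subtype
    refine top_le_iff.mp fun l _ => ?_
    have hc : Nat.card (K.map (MulAut.conj l).toMonoidHom) = Nat.card K :=
      Subgroup.card_map_of_injective (MulAut.conj l).injective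
    obtain ⟨v, hv, hvK⟩ := exists_conj_mem_of_coprime (V := V) (K := K)
      (K₂ := K.map (MulAut.conj l).toMonoidHom) (by rwa [hc, hKc])
      (Subgroup.disjoint_of_coprime_natCard (by rwa [hKc])) (by
        rw [← hsup]
        rintro _ ⟨k, hk, rfl⟩
        exact ‹M.Normal›.conj_mem k (hKM hk) l)
    have hn : v⁻¹ * l ∈ Subgroup.normalizer (K : Set L) := by
      have : Finite (K : Set L) := Set.toFinite _
      refine Subgroup.mem_normalizer_fintype fun k hk => ?_
      simpa [mul_assoc] using hvK _ ⟨k, hk, rfl⟩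
    have := Subgroup.mul_mem_sup hv hn
    rw [sup_comm]
    simpa using this

open scoped commutatorElement in
theorem hasNormal2Complement_of_isPGroup_normal {L : Type*} [Group L] [Finite L]
    {J : Subgroup L} (hJ : ∀ X : Subgroup L, X ⊔ J = ⊤ → X = ⊤) (V M : Subgroup L) [V.Normal]
    [M.Normal] (hVJ : V ≤ J) (hV : IsPGroup 2 V) (hVM : V ≤ M) (hodd : Odd (V.relIndex M))
    (hM : ∃ n : ℕ, M.index = 2 ^ n) : HasNormal2Complement L := by
  induction hc : Nat.card V using Nat.strong_induction_on generalizing V M with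
  | _ c ih =>
  subst hc
  by_cases hbot : V = ⊥
  · subst hbot
    exact ⟨M, inferInstance, by simpa using hodd, hM⟩
  obtain ⟨e, he⟩ := hV.exists_card_eq
  have : Fact (Nat.Prime 2) := ⟨Nat.prime_two⟩
  have hsolv : ⁅V, V⁆ < V := by
    have : Group.IsNilpotent V := hV.isNilpotent
    have : Nontrivial V := V.nontrivial_iff_ne_bot.mpr hbot
    have := Group.IsSolvable.commutator_lt_top_of_nontrivial V
    rw [← Subgroup.map_subtype_lt_map_subtype] at this
    rwa [map_commutator_eq, ← MonoidHom.range_eq_map, V.range_subtype] at this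
  set W := ⁅V, V⁆ with hW
  have hWV := hsolv.le
  let π := QuotientGroup.mk' W
  have hπ : Function.Surjective π := QuotientGroup.mk'_surjective W
  have hker : π.ker = W := QuotientGroup.ker_mk' W
  have : (V.map π).Normal := ‹V.Normal›.map π hπ
  have : (M.map π).Normal := ‹M.Normal›.map π hπ
  have : IsMulCommutative (V.map π) := by
    refine .of_comm ?_
    rintro ⟨_, x, hx, rfl⟩ ⟨_, y, hy, rfl⟩
    ext
    have : ⁅x, y⁆ ∈ π.ker :=
      hker.ge (Subgroup.commutator_mem_commutator hx hy)
    rwa [MonoidHom.mem_ker, map_commutatorElement, commutatorElement_eq_one_iff_mul_comm] at this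
  have hrel : (V.map π).relIndex (M.map π) = V.relIndex M := by
    rw [Subgroup.relIndex_map_map, hker, sup_of_le_left hWV, sup_of_le_left (hWV.trans hVM)]
  obtain ⟨e', he'⟩ := (hV.map π).exists_card_eq
  obtain ⟨K, hKM, hK, hKi, hKn⟩ := exists_complement_normalizer_sup_eq_top
    (Subgroup.map_mono (f := π) hVM)
    (by rw [hrel, he']; exact (Nat.coprime_two_left.mpr hodd).pow_left e')
  have hWK : W ≤ K.comap π := hker.ge.trans (π.ker_le_comap K)
  have hKnormal : (K.comap π).Normal := by
    rw [← Subgroup.normalizer_eq_top_iff, ← Subgroup.comap_normalizer_eq_of_surjective K hπ]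
    apply hJ
    have := congrArg (Subgroup.comap π) hKn
    rw [← Subgroup.comap_sup_eq _ _ _ hπ, Subgroup.comap_map_eq, hker, sup_of_le_left hWV,
      Subgroup.comap_top] at this
    exact top_le_iff.mp (this.symm.trans_le (sup_le_sup_left hVJ _))
  refine ih (Nat.card W) ?_ W (K.comap π) (hWV.trans hVJ) (hV.to_le hWV) hWK ?_ ?_ rfl
  · exact lt_of_le_of_ne (Subgroup.card_le_of_le hWV)
      fun h => hsolv.ne (Subgroup.eq_of_le_of_card_ge hWV h.ge)
  · have := Subgroup.relIndex_ker π (K := K.comap π)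
    rw [hker] at this
    rw [this, Subgroup.map_comap_eq_self_of_surjective hπ, hK, hrel]
    exact hodd
  · obtain ⟨n, hn⟩ := hM
    refine ⟨e' + n, ?_⟩
    rw [Subgroup.index_comap_of_surjective _ hπ, ← Subgroup.relIndex_mul_index hKM, hKi, he',
      Subgroup.index_map_eq _ hπ (hker.trans_le (hWV.trans hVM)), hn, pow_add]

theorem exists_supplement_hasNormal2Complement {D : Type*} [Group D] [Finite D]
    {D₀ : Subgroup D} [D₀.Normal] (hcomp : HasNormal2Complement (D ⧸ D₀)) {C : Subgroup D}
    (hC : C ⊔ D₀ = ⊤) : ∃ L ≤ C, L ⊔ D₀ = ⊤ ∧ HasNormal2Complement L := by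
  have : Fact (Nat.Prime 2) := ⟨Nat.prime_two⟩
  obtain ⟨L, hLC, hL⟩ := (Set.toFinite {L : Subgroup D | L ⊔ D₀ = ⊤}).exists_le_minimal hC
  refine ⟨L, hLC, hL.prop, ?_⟩
  have hJ : ∀ X : Subgroup L, X ⊔ D₀.subgroupOf L = ⊤ → X = ⊤ := by
    intro X hX
    have h1 : L ≤ X.map L.subtype ⊔ D₀ := by
      have := congrArg (Subgroup.map L.subtype) hX
      rw [Subgroup.map_sup, ← MonoidHom.range_eq_map, L.range_subtype,
        Subgroup.subgroupOf_map_subtype] at this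
      exact this.symm.trans_le (sup_le_sup_left inf_le_left _)
    have h2 : X.map L.subtype ⊔ D₀ = ⊤ :=
      top_le_iff.mp (hL.prop.symm.trans_le (sup_le h1 le_sup_right))
    have h3 := hL.eq_of_le h2 (Subgroup.map_subtype_le X)
    refine (Subgroup.map_injective L.subtype_injective) ?_
    rw [h3, ← MonoidHom.range_eq_map, L.range_subtype]
  obtain ⟨N, hN, hNodd, n, hn⟩ := hcomp
  let H := N.comap (QuotientGroup.mk' D₀)
  have hD₀H : D₀ ≤ H := QuotientGroup.le_comap_mk' D₀ N
  have hJH : D₀.subgroupOf L ≤ H.subgroupOf L := Subgroup.comap_mono hD₀H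
  have hodd : Odd ((D₀.subgroupOf L).relIndex (H.subgroupOf L)) := by
    rw [Subgroup.subgroupOf, Subgroup.relIndex_comap, Subgroup.subgroupOf_map_subtype]
    refine hNodd.of_dvd_nat ?_
    have : D₀ = (QuotientGroup.mk' D₀).ker := (QuotientGroup.ker_mk' D₀).symm
    conv_lhs => rw [this]
    rw [Subgroup.relIndex_ker]
    exact Subgroup.card_dvd_of_le (Subgroup.map_le_iff_le_comap.mpr inf_le_left)
  let U : Sylow 2 (D₀.subgroupOf L) := default
  have hUn : (U.map (D₀.subgroupOf L).subtype).Normal :=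
    Subgroup.normalizer_eq_top_iff.mp (hJ _ U.normalizer_sup_eq_top)
  have hUJ := Subgroup.map_subtype_le (U : Subgroup (D₀.subgroupOf L))
  refine hasNormal2Complement_of_isPGroup_normal hJ (U.map (D₀.subgroupOf L).subtype)
    (H.subgroupOf L) hUJ (U.isPGroup'.map _) (hUJ.trans hJH) ?_ ?_
  · rw [← Subgroup.relIndex_mul_relIndex _ _ _ hUJ hJH]
    refine Odd.mul ?_ hodd
    change Odd ((U.map (D₀.subgroupOf L).subtype).comap (D₀.subgroupOf L).subtype).index
    rw [Subgroup.comap_map_eq_self_of_injective (Subgroup.subtype_injective _)]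
    exact Nat.odd_iff.mpr (Nat.two_dvd_ne_zero.mp U.not_dvd_index)
  · have : H.relIndex L ∣ 2 ^ n := by
      rw [← hn, ← Subgroup.index_comap_of_surjective N (QuotientGroup.mk'_surjective D₀)]
      exact H.relIndex_dvd_index_of_normal L
    obtain ⟨k, -, hk⟩ := (Nat.dvd_prime_pow Nat.prime_two).mp this
    exact ⟨k, hk⟩

section

variable {G G' D : Type*} [Group G] [Group G'] [Group D] {φ : D →* MulAut G}
  {φ' : D →* MulAut G'} {D₀ : Subgroup D} {f : G →* G'}

theorem IsOrdinary.of_surjective (hord : IsOrdinary φ D₀) (hf : Function.Surjective f)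
    (heq : ∀ ψ g, f (φ ψ g) = φ' ψ (f g)) : IsOrdinary φ' D₀ := by
  intro x
  obtain ⟨g, rfl⟩ := hf x
  obtain ⟨α, hα, h⟩ := hord g
  refine ⟨α, hα, MulEquiv.ext fun y => ?_⟩
  obtain ⟨y, rfl⟩ := hf y
  rw [← heq, h]
  simp

theorem map_ker_eq_of_equivariant (heq : ∀ ψ g, f (φ ψ g) = φ' ψ (f g)) (ψ : D) :
    f.ker.map (φ ψ).toMonoidHom = f.ker := by
  ext x
  constructor
  · rintro ⟨y, hy, rfl⟩
    simp_all [MonoidHom.mem_ker]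
  · intro hx
    refine ⟨φ ψ⁻¹ x, ?_, by simp⟩
    change f (φ ψ⁻¹ x) = 1
    rw [heq, MonoidHom.mem_ker.mp hx, map_one]

theorem IsWild.of_odd_card_ker (hord : IsOrdinary φ D₀) (hwild : IsWild φ D₀)
    (hf : Function.Surjective f) (heq : ∀ ψ g, f (φ ψ g) = φ' ψ (f g))
    (hodd : Odd (Nat.card f.ker)) : IsWild φ' D₀ := by
  intro x hx
  obtain ⟨g, rfl⟩ := hf x
  obtain ⟨k, hk⟩ := hodd
  have hpow : ∀ b ∈ f.ker, b ^ (2 * k + 1) = 1 := fun b hb => by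
    rw [← hk]
    exact congrArg Subtype.val (pow_card_eq_one' (x := (⟨b, hb⟩ : f.ker)))
  have hg2 : f g ^ 2 = 1 := hx ▸ pow_orderOf_eq_one (f g)
  set a := g ^ (2 * k + 1) with ha
  have hfa : f a = f g := by
    rw [ha, map_pow, pow_succ, pow_mul, hg2, one_pow, one_mul]
  have ha2 : a ^ 2 = 1 := by
    rw [ha, ← pow_mul, mul_comm, pow_mul]
    exact hpow _ (by rw [MonoidHom.mem_ker, map_pow, hg2])
  have hord2 : orderOf a = 2 := by
    refine orderOf_eq_prime ha2 fun h => ?_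
    rw [← hfa, h, map_one, orderOf_one] at hx
    exact absurd hx (by norm_num)
  refine lt_of_le_of_lt (sup_le (fun ψ hψ => ?_) le_sup_right) (hwild a hord2)
  have hψ' : φ' ψ (f g) = f g := hψ
  set b := a⁻¹ * φ ψ a with hb
  have hbker : b ∈ f.ker := by
    rw [MonoidHom.mem_ker, hb, map_mul, heq, map_inv, hfa, hψ', inv_mul_cancel]
  have hab : φ ψ a = a * b := by rw [hb, mul_inv_cancel_left]
  have hainv : a⁻¹ = a := inv_eq_of_mul_eq_one_left (by rw [← sq, ha2])
  have hconj : a * b * a⁻¹ = b⁻¹ := by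
    rw [eq_inv_iff_mul_eq_one, hainv, mul_assoc (a * b), ← hab, ← sq, ← map_pow, ha2, map_one]
  obtain ⟨α, hα, hαc⟩ := hord (b ^ k)
  have hαa : φ α a = φ ψ a := by
    have h1 : a * b ^ k * a⁻¹ = (b ^ k)⁻¹ := by rw [← conj_pow, hconj, inv_pow]
    have h2 : b ^ k * a = a * (b ^ k)⁻¹ := by
      rw [← h1, hainv, ← mul_assoc, ← mul_assoc, ← sq, ha2, one_mul]
    have h3 : b = (b ^ k)⁻¹ * (b ^ k)⁻¹ := by
      rw [← mul_inv_rev, ← pow_add, eq_inv_iff_mul_eq_one, ← pow_succ', ← two_mul]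
      exact hpow b hbker
    rw [hαc, MulAut.conj_apply, hab, h2, mul_assoc, ← h3]
  have hstab : α⁻¹ * ψ ∈ (MulAction.stabilizer (MulAut G) a).comap φ := by
    change φ (α⁻¹ * ψ) a = a
    rw [map_mul, MulAut.mul_apply, ← hαa, ← MulAut.mul_apply, ← map_mul, inv_mul_cancel, map_one,
      MulAut.one_apply]
  have := Subgroup.mul_mem_sup (T := (MulAction.stabilizer (MulAut G) a).comap φ) hα hstab
  rw [sup_comm]
  simpa using this

/-- The subgroup of points of `f ⁻¹ (A)` fixed by the elements of `P`. -/
def fixedInComap (φ : D →* MulAut G) (P : Subgroup D) (f : G →* G') (A : Subgroup G') :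
    Subgroup G where
  carrier := {x | f x ∈ A ∧ ∀ m ∈ P, φ m x = x}
  mul_mem' := fun hx hy => ⟨by simpa using A.mul_mem hx.1 hy.1, fun m hm => by
    rw [map_mul, hx.2 m hm, hy.2 m hm]⟩
  one_mem' := ⟨by simp, fun m _ => map_one _⟩
  inv_mem' := fun hx => ⟨by simpa using hx.1, fun m hm => by rw [map_inv, hx.2 m hm]⟩

theorem exists_mem_fixed_of_coprime [Finite D] [IsMulCommutative f.ker] (P : Subgroup D)
    (hcop : (Nat.card f.ker).Coprime (Nat.card P))
    (heq : ∀ ψ g, f (φ ψ g) = φ' ψ (f g)) {a : G} (ha : ∀ m ∈ P, φ' m (f a) = f a) :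
    ∃ x, f x = f a ∧ ∀ m ∈ P, φ m x = x := by
  obtain ⟨v, hv⟩ := exists_coboundary_of_coprime hcop
    (fun m : P => ((φ m).toMonoidHom.comp f.ker.subtype).codRestrict f.ker fun y => by
      change f (φ m y) = 1
      rw [heq, MonoidHom.mem_ker.mp y.2, map_one])
    (fun m => ⟨φ m a * a⁻¹, by simp [MonoidHom.mem_ker, heq, ha m m.2]⟩)
    (fun m k => by
      ext
      simp [mul_assoc])
  refine ⟨v * a, by rw [map_mul, v.2, one_mul], fun m hm => ?_⟩
  have h := congrArg Subtype.val (hv ⟨m, hm⟩)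
  have h' : (v : G) = φ m v * (φ m a * a⁻¹) := h
  rw [map_mul]
  conv_rhs => rw [h']
  group

theorem IsWild.of_sq_ker_eq_one [Finite G] [Finite D] [D₀.Normal]
    (hcomp : HasNormal2Complement (D ⧸ D₀)) (hwild : IsWild φ D₀)
    (hf : Function.Surjective f) (heq : ∀ ψ g, f (φ ψ g) = φ' ψ (f g))
    (hker : ∀ x ∈ f.ker, x * x = 1) : IsWild φ' D₀ := by
  have : Fact (Nat.Prime 2) := ⟨Nat.prime_two⟩
  have hkerp : IsPGroup 2 f.ker := fun x => ⟨1, by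
    ext; simpa [sq] using hker x x.2⟩
  have : IsMulCommutative f.ker := .of_comm fun x y => by
    have h : ∀ z : f.ker, z * z = 1 := fun z => Subtype.ext (hker z z.2)
    exact (Commute.of_orderOf_dvd_two (fun z => orderOf_dvd_of_pow_eq_one (by rw [sq, h z])) x y)
  intro a' ha'
  by_contra hC
  obtain ⟨L, hLC, hL, M, hM, hMo, n, hMi⟩ :=
    exists_supplement_hasNormal2Complement hcomp (not_lt_top_iff.mp hC)
  have hLa : ∀ l ∈ L, φ' l a' = a' := fun l hl => hLC hl
  obtain ⟨a, rfl⟩ := hf a'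
  obtain ⟨e, he⟩ := hkerp.exists_card_eq
  obtain ⟨x, hxa, hx⟩ := exists_mem_fixed_of_coprime (M.map L.subtype) (f := f) (a := a)
    (by
      rw [he, Subgroup.card_map_of_injective L.subtype_injective]
      exact (Nat.coprime_two_left.mpr hMo).pow_left e) heq
    (fun m hm => hLa m (Subgroup.map_subtype_le M hm))
  set F := fixedInComap φ (M.map L.subtype) f (Subgroup.zpowers (f a))
  have hFp : IsPGroup 2 F := by
    refine IsPGroup.to_le (IsPGroup.comap_of_ker_isPGroup (H := Subgroup.zpowers (f a)) ?_ f hkerp)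
      fun y hy => hy.1
    exact IsPGroup.of_card (n := 1) (by rw [Nat.card_zpowers, ha', pow_one])
  have hxF : x ∈ F := ⟨hxa ▸ Subgroup.mem_zpowers _, hx⟩
  have hx1 : x ≠ 1 := by
    rintro rfl
    rw [← hxa, map_one, orderOf_one] at ha'
    exact absurd ha' (by norm_num)
  have hFnt : Nontrivial F := F.nontrivial_iff_exists_ne_one.mpr ⟨x, hxF, hx1⟩
  have hFstab : ∀ l ∈ L, ∀ y ∈ F, φ l y ∈ F := by
    rintro l hl y ⟨⟨k, hk⟩, hy⟩
    refine ⟨⟨k, ?_⟩, ?_⟩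
    · rw [heq, ← hk, map_zpow, hLa l hl]
    · rintro _ ⟨m, hm, rfl⟩
      have h := hy _ ⟨_, hM.conj_mem m hm (⟨l, hl⟩⁻¹), rfl⟩
      conv_rhs => rw [← h]
      simp [← MulAut.mul_apply, ← map_mul, mul_assoc]
  let _ : MulAction L F :=
    { smul := fun l y => ⟨φ l y, hFstab l l.2 y y.2⟩
      one_smul := fun y => Subtype.ext (by change φ ((1 : L) : D) y = y; simp)
      mul_smul := fun l l' y => Subtype.ext (by
        change φ ((l * l' : L) : D) y = φ l (φ l' y); simp) }
  let Q : Sylow 2 L := default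
  obtain ⟨k, hk0, hk⟩ := hFp.nontrivial_iff_card.mp hFnt
  obtain ⟨b, hbQ, hb1⟩ := Q.isPGroup'.exists_fixed_point_of_prime_dvd_card_of_fixed_point F
    (hk ▸ dvd_pow_self 2 hk0.ne') (a := 1) (fun q => Subtype.ext (map_one (φ (q : L))))
  have hstab : ((MulAction.stabilizer (MulAut G) (b : G)).comap φ).subgroupOf L = ⊤ := by
    rw [← Subgroup.index_eq_one]
    refine Nat.eq_one_of_dvd_coprimes (a := 2 ^ n) (b := (Q : Subgroup L).index) ?_ ?_ ?_
    · exact (((Nat.Prime.coprime_iff_not_dvd Nat.prime_two).mpr Q.not_dvd_index)).pow_left n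
    · rw [← hMi]
      exact Subgroup.index_dvd_of_le fun m hm => b.2.2 m ⟨m, hm, rfl⟩
    · exact Subgroup.index_dvd_of_le fun q hq => congrArg Subtype.val (hbQ ⟨q, hq⟩)
  have hbord : 2 ∣ orderOf (b : G) := by
    obtain ⟨j, hj⟩ := IsPGroup.iff_orderOf.mp hFp b
    rw [Subgroup.orderOf_coe, hj]
    refine dvd_pow_self 2 ?_
    rintro rfl
    exact hb1 (orderOf_eq_one_iff.mp hj).symm
  refine (hwild _ (orderOf_pow_orderOf_div (orderOf_pos (b : G)).ne' hbord)).ne ?_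
  refine top_le_iff.mp (hL.symm.trans_le (sup_le_sup_right (fun l hl => ?_) _))
  have hlb : φ l b = b := Subgroup.subgroupOf_eq_top.mp hstab hl
  change φ l (b ^ _) = b ^ _
  rw [map_pow, hlb]

end

theorem inducedQuotHom_mk {G D : Type*} [Group G] [Group D] (φ : D →* MulAut G) (B : Subgroup G)
    [B.Normal] (hB : ∀ ψ : D, B.map (φ ψ).toMonoidHom = B) (ψ : D) (g : G) :
    QuotientGroup.mk' B (φ ψ g) = inducedQuotHom φ B hB ψ (QuotientGroup.mk' B g) :=
  rfl

theorem IsOrdinary.normal_of_map_eq {G D : Type*} [Group G] [Group D] {φ : D →* MulAut G}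
    {D₀ : Subgroup D} (hord : IsOrdinary φ D₀) {W : Subgroup G}
    (hW : ∀ ψ : D, W.map (φ ψ).toMonoidHom = W) : W.Normal := by
  refine ⟨fun x hx g => ?_⟩
  obtain ⟨α, -, h⟩ := hord g
  rw [← MulAut.conj_apply, ← h, ← hW α]
  exact ⟨x, hx, rfl⟩

theorem IsWild.of_surjective.{u, w} {D : Type w} [Group D] [Finite D] {D₀ : Subgroup D}
    [D₀.Normal] (hcomp : HasNormal2Complement (D ⧸ D₀)) {G G' : Type u} [Group G]
    [Finite G] [Group G'] {φ : D →* MulAut G} {φ' : D →* MulAut G'} {f : G →* G'}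
    (hord : IsOrdinary φ D₀) (hwild : IsWild φ D₀) (hf : Function.Surjective f)
    (heq : ∀ ψ g, f (φ ψ g) = φ' ψ (f g)) (hsolv : Group.IsSolvable f.ker) : IsWild φ' D₀ := by
  induction hc : Nat.card f.ker using Nat.strong_induction_on generalizing G G' with
  | _ c ih =>
  subst hc
  have step : ∀ W : Subgroup G, (∀ ψ : D, W.map (φ ψ).toMonoidHom = W) → W < f.ker → W ≠ ⊥ →
      IsWild φ' D₀ := by
    intro W hW hlt hbot
    have := hord.normal_of_map_eq hW
    have hker : (QuotientGroup.mk' W).ker = W := QuotientGroup.ker_mk' W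
    have hcardlt : Nat.card W < Nat.card f.ker := by
      refine (Subgroup.card_le_of_le hlt.le).lt_of_ne fun h => hlt.ne ?_
      exact Subgroup.eq_of_le_of_card_ge hlt.le h.ge
    have hWsolv : Group.IsSolvable W :=
      Group.isSolvable_of_isSolvable_injective (Subgroup.inclusion_injective hlt.le)
    have hπ := QuotientGroup.mk'_surjective W
    have hwild' : IsWild (inducedQuotHom φ W hW) D₀ :=
      ih _ (by rwa [hker]) hord hwild hπ (inducedQuotHom_mk φ W hW) (by rwa [hker]) rfl
    have hord' : IsOrdinary (inducedQuotHom φ W hW) D₀ :=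
      hord.of_surjective hπ (inducedQuotHom_mk φ W hW)
    have hkl : (QuotientGroup.lift W f hlt.le).ker = f.ker.map (QuotientGroup.mk' W) :=
      QuotientGroup.ker_lift W f hlt.le
    refine ih _ ?_ hord' hwild' (f := QuotientGroup.lift W f hlt.le) ?_ ?_ ?_ rfl
    · rw [hkl, ← Subgroup.relIndex_ker, hker, ← Subgroup.relIndex_bot_left f.ker,
        ← Subgroup.relIndex_mul_relIndex ⊥ W f.ker bot_le hlt.le, Subgroup.relIndex_bot_left]
      refine lt_mul_of_one_lt_left (Nat.pos_of_ne_zero Subgroup.index_ne_zero_of_finite) ?_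
      exact W.one_lt_card_iff_ne_bot.mpr hbot
    · intro y
      obtain ⟨g, rfl⟩ := hf y
      exact ⟨g, rfl⟩
    · intro ψ x
      obtain ⟨g, rfl⟩ := hπ x
      exact heq ψ g
    · rw [hkl]
      exact Group.isSolvable_of_surjective ((QuotientGroup.mk' W).subgroupMap_surjective f.ker)
  rcases Nat.even_or_odd (Nat.card f.ker) with heven | hodd
  swap
  · exact hwild.of_odd_card_ker hord hf heq hodd
  have hB := map_ker_eq_of_equivariant heq
  have : Fact (Nat.Prime 2) := ⟨Nat.prime_two⟩
  obtain ⟨z, hz⟩ := exists_prime_orderOf_dvd_card' (G := f.ker) 2 heven.two_dvd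
  have hz1 : z ≠ 1 := by
    rintro rfl
    rw [orderOf_one] at hz
    exact absurd hz (by norm_num)
  have : Nontrivial f.ker := ⟨z, 1, hz1⟩
  by_cases hcb : ⁅f.ker, f.ker⁆ = ⊥
  swap
  · refine step _ (fun ψ => by rw [Subgroup.map_commutator, hB]) ?_ hcb
    have := Group.IsSolvable.commutator_lt_top_of_nontrivial f.ker
    rw [← Subgroup.map_subtype_lt_map_subtype] at this
    rwa [map_commutator_eq, ← MonoidHom.range_eq_map, f.ker.range_subtype] at this
  have hcomm : ∀ x ∈ f.ker, ∀ y ∈ f.ker, x * y = y * x := fun x hx y hy =>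
    (Subgroup.mem_centralizer_iff.mp
      (Subgroup.commutator_eq_bot_iff_le_centralizer.mp hcb hy) x hx)
  let W : Subgroup G :=
    { carrier := {x | ∃ b ∈ f.ker, b * b = x}
      mul_mem' := by
        rintro _ _ ⟨a, ha, rfl⟩ ⟨b, hb, rfl⟩
        exact ⟨a * b, mul_mem ha hb, by
          rw [mul_assoc, ← mul_assoc b, hcomm b hb a ha]; simp only [mul_assoc]⟩
      one_mem' := ⟨1, one_mem _, one_mul 1⟩
      inv_mem' := by
        rintro _ ⟨a, ha, rfl⟩
        exact ⟨a⁻¹, inv_mem ha, (mul_inv_rev a a).symm⟩ }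
  have hWB : W ≤ f.ker := by
    rintro _ ⟨a, ha, rfl⟩
    exact mul_mem ha ha
  by_cases hWbot : W = ⊥
  · exact hwild.of_sq_ker_eq_one hcomp hf heq fun x hx =>
      Subgroup.mem_bot.mp (hWbot ▸ (⟨x, hx, rfl⟩ : x * x ∈ W))
  refine step W (fun ψ => ?_) (hWB.lt_of_ne fun h => hz1 ?_) hWbot
  · have hmem : ∀ ψ, ∀ x ∈ f.ker, φ ψ x ∈ f.ker := fun ψ x hx => hB ψ ▸ ⟨x, hx, rfl⟩
    ext x
    constructor
    · rintro ⟨_, ⟨b, hb, rfl⟩, rfl⟩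
      exact ⟨φ ψ b, hmem ψ b hb, (map_mul (φ ψ) b b).symm⟩
    · rintro ⟨b, hb, rfl⟩
      exact ⟨_, ⟨φ ψ⁻¹ b, hmem _ b hb, rfl⟩, by simp⟩
  · have hsurj : Function.Surjective fun b : f.ker => b * b := by
      rintro ⟨x, hx⟩
      obtain ⟨b, hb, rfl⟩ := h.ge hx
      exact ⟨⟨b, hb⟩, rfl⟩
    refine Finite.injective_iff_surjective.mpr hsurj ?_
    rw [← sq, ← hz, pow_orderOf_eq_one, one_mul]

/-- If `(G, D₀, D₁)` is a wild ordinary triplet, `D₁/D₀` has a normal 2-complement,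
and `B` is a solvable `D₁`-invariant subgroup of `G`, then the induced triplet
`(G/B, D₀, D₁)` is wild. -/
theorem stmt_9 (G D : Type) [Group G] [Finite G] [Group D] [Finite D]
    (D₀ : Subgroup D) [D₀.Normal] (φ : D →* MulAut G)
    (hord : IsOrdinary φ D₀) (hwild : IsWild φ D₀)
    (hcomp : HasNormal2Complement (D ⧸ D₀))
    (B : Subgroup G) [B.Normal] (hB : ∀ ψ : D, B.map (φ ψ).toMonoidHom = B)
    (hsolv : IsSolvable B) :
    IsWild (inducedQuotHom φ B hB) D₀ := by
  refine hwild.of_surjective hcomp hord (QuotientGroup.mk'_surjective B)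
    (inducedQuotHom_mk φ B hB) ?_
  rwa [QuotientGroup.ker_mk']
end

section
/- Let p be a prime and G a finite group. Suppose H is a normal subgroup of G whose order is not divisible by p, the quotient G/H is ⟨p⟩-wild, and the natural map from the setwise stabilizer N_{Aut(G)}(H) = {φ ∈ Aut(G) : φ(H) = H} to Aut(G/H) (sending φ to the induced automorphism of G/H) is surjective. Then G is ⟨p⟩-wild. -/
/-- `G` is `⟨q⟩`-wild iff no element `x` of order `q` has the conjugacy class of
`⟨x⟩` characteristic (i.e. for every `x` of order `q` some automorphism sends `⟨x⟩`
outside the `G`-conjugacy class of `⟨x⟩`). -/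
def PWild (q : ℕ) (G : Type*) [Group G] : Prop :=
  ¬ ∃ x : G, orderOf x = q ∧ ∀ e : MulAut G, ∃ g : G,
    (Subgroup.zpowers x).map e.toMonoidHom =
      (Subgroup.zpowers x).map (MulAut.conj g).toMonoidHom

/-- If `H ⊴ G` is a normal `p'`-subgroup such that `G/H` is `⟨p⟩`-wild and the natural
map `N_{Aut(G)}(H) → Aut(G/H)` is surjective, then `G` is `⟨p⟩`-wild. -/
theorem stmt_16 (p : ℕ) (hp : p.Prime) (G : Type) [Group G] [Finite G]
    (H : Subgroup G) [H.Normal] (hH : ¬ p ∣ Nat.card H)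
    (hquot : PWild p (G ⧸ H))
    (hsurj : Function.Surjective
      (fun e : {e : MulAut G // H.map e.toMonoidHom = H} =>
        (QuotientGroup.congr H H e.1 e.2 : (G ⧸ H) ≃* (G ⧸ H)))) :
    PWild p G := by
  rintro ⟨x, hx, hchar⟩
  have hmap : (Subgroup.zpowers x).map (QuotientGroup.mk' H) =
      Subgroup.zpowers (x : G ⧸ H) := MonoidHom.map_zpowers _ _
  refine hquot ⟨(x : G ⧸ H), ?_, fun f => ?_⟩
  · have := Fact.mk hp
    refine orderOf_eq_prime ?_ fun h => hH ?_
    · rw [← QuotientGroup.mk_pow, ← hx, pow_orderOf_eq_one, QuotientGroup.mk_one]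
    · rw [← hx]
      exact H.orderOf_dvd_natCard ((QuotientGroup.eq_one_iff x).mp h)
  · obtain ⟨e, rfl⟩ := hsurj f
    obtain ⟨g, hg⟩ := hchar e.1
    refine ⟨(g : G ⧸ H), ?_⟩
    have h := congrArg (Subgroup.map (QuotientGroup.mk' H)) hg
    rw [← hmap, Subgroup.map_map, Subgroup.map_map]
    rw [Subgroup.map_map, Subgroup.map_map] at h
    exact h
end
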